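/- arXiv:math/0410005 — 3 statements merged into one kernel-verified Lean document; each statement's English description precedes it below -/
import Mathlib

section
/- Let A be a ring, let M = ⊕_{i∈ℤ} M_i and P = ⊕_{i∈ℤ} P_i be A-modules equipped with internal ℤ-gradings by submodules, and suppose M is bounded below (there is i₀ ∈ ℤ with M_i = 0 for all i < i₀). Let f₁, f₂ : M → P be A-linear maps such that f₁ is homogeneous of some degree δ (f₁(M_i) ⊆ P_{i+δ} for all i) and f₂ strictly lowers degree relative to δ (f₂(M_i) ⊆ ⊕_{j < i+δ} P_j for all i). Suppose there is an A-linear map R : P → M, homogeneous of degree −δ (R(P_i) ⊆ M_{i−δ}), satisfying f₁(R(y)) = y for every y in the range of f₂. Then there exists an A-linear automorphism g of M such that f₁ = (f₁ + f₂) ∘ g. In particular, range(f₁ + f₂) = range(f₁), and ker(f₁ + f₂) is the image of ker(f₁) under g, hence is isomorphic to ker(f₁) as an A-module. -/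
/-- If `N` lowers an exhaustive `ℕ`-indexed filtration starting at `⊥`, then `id + N` is
bijective. -/
theorem LinearMap.bijective_id_add_of_map_filtration_le {A M : Type*} [Ring A] [AddCommGroup M]
    [Module A M] (N : M →ₗ[A] M) (F : ℕ → Submodule A M) (hzero : F 0 = ⊥)
    (hmap : ∀ n, (F (n + 1)).map N ≤ F n) (hexh : ∀ x, ∃ n, x ∈ F n) :
    Function.Bijective (LinearMap.id + N : M →ₗ[A] M) := by
  constructor
  · refine (injective_iff_map_eq_zero _).2 fun x hx => ?_
    obtain ⟨n, hn⟩ := hexh x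
    induction n with
    | zero => simpa [hzero] using hn
    | succ n ih =>
      have hxN : x = -N x := eq_neg_of_add_eq_zero_left hx
      refine ih ?_
      rw [hxN]
      exact neg_mem (hmap n (Submodule.mem_map_of_mem hn))
  · intro x
    obtain ⟨n, hn⟩ := hexh x
    induction n generalizing x with
    | zero => exact ⟨0, by simpa [hzero, eq_comm] using hn⟩
    | succ n ih =>
      obtain ⟨y, hy⟩ := ih (N x) (hmap n (Submodule.mem_map_of_mem hn))
      exact ⟨x - y, by rw [map_sub, hy]; simp⟩

/-- An endomorphism that strictly lowers the degree of a bounded below `ℤ`-grading becomes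
bijective after adding the identity. -/
theorem LinearMap.bijective_id_add_of_lowers_degree {A M : Type*} [Ring A] [AddCommGroup M]
    [Module A M] (Mgr : ℤ → Submodule A M) (htop : ⨆ i, Mgr i = ⊤) (i₀ : ℤ)
    (hbound : ∀ i < i₀, Mgr i = ⊥) (N : M →ₗ[A] M)
    (hN : ∀ i, (Mgr i).map N ≤ ⨆ j : ℤ, ⨆ _ : j < i, Mgr j) :
    Function.Bijective (LinearMap.id + N : M →ₗ[A] M) := by
  have hmono : Monotone fun k : ℤ => ⨆ j : ℤ, ⨆ _ : j < k, Mgr j := fun _ _ hkl =>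
    iSup₂_le fun j hj => le_iSup₂_of_le j (hj.trans_le hkl) le_rfl
  refine N.bijective_id_add_of_map_filtration_le
    (fun n : ℕ => ⨆ j : ℤ, ⨆ _ : j < i₀ + n, Mgr j) ?_ ?_ ?_
  · simpa using hbound
  · intro n
    simp only [Submodule.map_iSup]
    exact iSup₂_le fun j hj => (hN j).trans (hmono (by push_cast at hj; omega))
  · intro x
    rw [← Submodule.mem_iSup_of_directed]
    · have hle : ⨆ i, Mgr i ≤ ⨆ n : ℕ, ⨆ j : ℤ, ⨆ _ : j < i₀ + n, Mgr j :=
        iSup_le fun i => le_iSup_of_le (i - i₀ + 1).toNat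
          (le_iSup₂_of_le i (by omega) le_rfl)
      exact hle (htop ▸ Submodule.mem_top)
    · exact Monotone.directed_le fun m n hmn => hmono (by omega)


/-- Lemma 2.4 of the paper, graded form.
If `M` and `P` are internally ℤ-graded `A`-modules, `M` is bounded below,
`f₁` is homogeneous of degree `δ`, `f₂` strictly lowers degree relative to `δ`,
and `R` is a homogeneous right inverse of `f₁` defined on the range of `f₂`,
then there is an automorphism `g` of `M` with `f₁ = (f₁ + f₂) ∘ g`;
in particular `range (f₁ + f₂) = range f₁` and
`ker (f₁ + f₂) = g (ker f₁) ≅ ker f₁`. -/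
theorem stmt0 {A : Type*} [Ring A] {M P : Type*}
    [AddCommGroup M] [Module A M] [AddCommGroup P] [Module A P]
    (Mgr : ℤ → Submodule A M) (Pgr : ℤ → Submodule A P)
    (hM : DirectSum.IsInternal Mgr) (hP : DirectSum.IsInternal Pgr)
    (i₀ : ℤ) (hbound : ∀ i : ℤ, i < i₀ → Mgr i = ⊥)
    (f₁ f₂ : M →ₗ[A] P) (δ : ℤ)
    (hf₁ : ∀ i : ℤ, (Mgr i).map f₁ ≤ Pgr (i + δ))
    (hf₂ : ∀ i : ℤ, (Mgr i).map f₂ ≤ ⨆ j : ℤ, ⨆ _ : j < i + δ, Pgr j)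
    (R : P →ₗ[A] M)
    (hR : ∀ i : ℤ, (Pgr i).map R ≤ Mgr (i - δ))
    (hRinv : ∀ y ∈ LinearMap.range f₂, f₁ (R y) = y) :
    ∃ g : M ≃ₗ[A] M,
      f₁ = (f₁ + f₂) ∘ₗ (g : M →ₗ[A] M) ∧
      LinearMap.range (f₁ + f₂) = LinearMap.range f₁ ∧
      LinearMap.ker (f₁ + f₂) = (LinearMap.ker f₁).map (g : M →ₗ[A] M) ∧
      Nonempty ((LinearMap.ker (f₁ + f₂)) ≃ₗ[A] (LinearMap.ker f₁)) := by
  have hN : ∀ i, (Mgr i).map (R ∘ₗ f₂) ≤ ⨆ j : ℤ, ⨆ _ : j < i, Mgr j := by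
    intro i
    rw [Submodule.map_comp]
    refine (Submodule.map_mono (hf₂ i)).trans ?_
    simp only [Submodule.map_iSup]
    exact iSup₂_le fun j hj => (hR j).trans (le_iSup₂_of_le (j - δ) (by omega) le_rfl)
  let h : M ≃ₗ[A] M := LinearEquiv.ofBijective (LinearMap.id + R ∘ₗ f₂)
    (LinearMap.bijective_id_add_of_lowers_degree Mgr hM.submodule_iSup_eq_top i₀ hbound _ hN)
  have hcomp : ∀ x, f₁ (h x) = (f₁ + f₂) x := fun x => by
    simp [h, hRinv (f₂ x) ⟨x, rfl⟩]
  have hfac : f₁ = (f₁ + f₂) ∘ₗ (h.symm : M →ₗ[A] M) := by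
    ext x
    simpa using hcomp (h.symm x)
  have hker : LinearMap.ker (f₁ + f₂) = (LinearMap.ker f₁).map (h.symm : M →ₗ[A] M) := by
    ext x
    rw [Submodule.mem_map_equiv, LinearEquiv.symm_symm, LinearMap.mem_ker, LinearMap.mem_ker,
      hcomp]
  refine ⟨h.symm, hfac, ?_, hker, ?_⟩
  · conv_rhs => rw [hfac]
    exact (LinearMap.range_comp_of_range_eq_top _ h.symm.range).symm
  · exact ⟨(LinearEquiv.ofEq _ _ hker).trans (h.symm.submoduleMap (LinearMap.ker f₁)).symm⟩
end

section
/- Let A be a ring, M and P be A-modules, and f₁, f₂ : M → P be A-linear maps. Suppose there is an A-linear map R : P → M such that f₁(R(y)) = y for every y in the range of f₂, and suppose the composite R ∘ f₂ : M → M is locally nilpotent, i.e. for every x ∈ M there exists n ∈ ℕ with (R ∘ f₂)ⁿ(x) = 0. Then there exists an A-linear automorphism g of M with f₁ = (f₁ + f₂) ∘ g; consequently range(f₁ + f₂) = range(f₁) and ker(f₁ + f₂) = g(ker f₁), so ker(f₁ + f₂) and ker(f₁) are isomorphic A-modules. -/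
/-- If `N` is locally nilpotent, then `1 + N` is bijective. -/
theorem LinearMap.bijective_one_add_of_locally_nilpotent {A M : Type*} [Ring A]
    [AddCommGroup M] [Module A M] {N : M →ₗ[A] M} (hN : ∀ x, ∃ n : ℕ, (N ^ n) x = 0) :
    Function.Bijective (1 + N : M →ₗ[A] M) := by
  constructor
  · rw [injective_iff_map_eq_zero]
    intro x hx
    obtain ⟨n, hn⟩ := hN x
    induction n generalizing x with
    | zero => simpa using hn
    | succ n ih =>
      have hx' : x + N x = 0 := by simpa using hx
      have hNx : N x = 0 := by
        refine ih (N x) ?_ (by rwa [pow_succ, Module.End.mul_apply] at hn)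
        simpa using congrArg N hx'
      simpa [hNx] using hx'
  · intro x
    obtain ⟨n, hn⟩ := hN x
    induction n generalizing x with
    | zero => exact ⟨0, by simpa using hn.symm⟩
    | succ n ih =>
      obtain ⟨z, hz⟩ := ih (N x) (by rwa [pow_succ, Module.End.mul_apply] at hn)
      refine ⟨x - z, ?_⟩
      rw [map_sub, hz]
      simp

/-- abstract form of Lemma 2.4 of the paper.
If `R` is a right inverse of `f₁` on the range of `f₂` and `R ∘ f₂` is locally
nilpotent, then there is an automorphism `g` of `M` with `f₁ = (f₁ + f₂) ∘ g`;
consequently `range (f₁ + f₂) = range f₁` and `ker (f₁ + f₂) = g (ker f₁)`,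
so `ker (f₁ + f₂)` and `ker f₁` are isomorphic `A`-modules. -/
theorem stmt1 {A : Type*} [Ring A] {M P : Type*}
    [AddCommGroup M] [Module A M] [AddCommGroup P] [Module A P]
    (f₁ f₂ : M →ₗ[A] P) (R : P →ₗ[A] M)
    (hRinv : ∀ y ∈ LinearMap.range f₂, f₁ (R y) = y)
    (hnilp : ∀ x : M, ∃ n : ℕ, ((R ∘ₗ f₂) ^ n) x = 0) :
    ∃ g : M ≃ₗ[A] M,
      f₁ = (f₁ + f₂) ∘ₗ (g : M →ₗ[A] M) ∧
      LinearMap.range (f₁ + f₂) = LinearMap.range f₁ ∧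
      LinearMap.ker (f₁ + f₂) = (LinearMap.ker f₁).map (g : M →ₗ[A] M) ∧
      Nonempty ((LinearMap.ker (f₁ + f₂)) ≃ₗ[A] (LinearMap.ker f₁)) := by
  let e : M ≃ₗ[A] M :=
    LinearEquiv.ofBijective _ (LinearMap.bijective_one_add_of_locally_nilpotent hnilp)
  have he : f₁ ∘ₗ (e : M →ₗ[A] M) = f₁ + f₂ := by
    ext x
    simp [e, hRinv (f₂ x) ⟨x, rfl⟩]
  have hker : LinearMap.ker (f₁ + f₂) =
      (LinearMap.ker f₁).map (e.symm : M →ₗ[A] M) := by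
    rw [← he, LinearMap.ker_comp]
    exact (Submodule.map_equiv_eq_comap_symm e.symm _).symm
  refine ⟨e.symm, ?_, ?_, hker, ?_⟩
  · rw [← he]
    ext x
    simp
  · rw [← he]
    exact LinearEquiv.range_comp e f₁
  · rw [hker]
    exact ⟨(e.symm.submoduleMap _).symm⟩
end

section
/- Let A be a ring and let M, P, X, X′ be A-modules. Let f : M → P be an A-linear map, and suppose there are A-linear maps g : P → X, h : X → M and g′ : P → X′, h′ : X′ → M such that both triples (f, g, h) and (f, g′, h′) form exact triangles: range(f) = ker(g), range(g) = ker(h), range(h) = ker(f), and likewise range(f) = ker(g′), range(g′) = ker(h′), range(h′) = ker(f). If Ext¹_A(ker(f), P⧸range(f)) = 0, then X and X′ are isomorphic as A-modules. -/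
open CategoryTheory

universe u

namespace CategoryTheory

open Limits

/-- If `Ext¹(X, Y)` vanishes, every 1-cocycle on a projective resolution of `X` with values in `Y`
is a coboundary. -/
lemma ProjectiveResolution.exists_d_comp_eq_of_subsingleton_ext_one
    {R C : Type*} [Ring R] [Category* C] [Abelian C] [Linear R C] [EnoughProjectives C]
    {X Y : C} (P : ProjectiveResolution X)
    [hext : Subsingleton (((Ext R C 1).obj (Opposite.op X)).obj Y)]
    (φ : P.complex.X 1 ⟶ Y) (hφ : P.complex.d 2 1 ≫ φ = 0) :
    ∃ ψ : P.complex.X 0 ⟶ Y, P.complex.d 1 0 ≫ ψ = φ := by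
  have hz : IsZero ((P.complex.linearYonedaObj R Y).homology 1) :=
    (ModuleCat.isZero_of_subsingleton _).of_iso (P.isoExt 1 Y).symm
  rw [← HomologicalComplex.exactAt_iff_isZero_homology,
    HomologicalComplex.exactAt_iff' _ 0 1 2 (by simp) (by simp),
    ShortComplex.moduleCat_exact_iff] at hz
  exact hz φ hφ

/-- A short exact sequence splits if the first `Ext` group of its outer terms vanishes. -/
lemma ShortComplex.ShortExact.nonempty_splitting_of_subsingleton_ext_one
    (R : Type*) {C : Type*} [Ring R] [Category* C] [Abelian C] [Linear R C] [EnoughProjectives C]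
    {S : ShortComplex C} (hS : S.ShortExact)
    [Subsingleton (((Ext R C 1).obj (Opposite.op S.X₃)).obj S.X₁)] :
    Nonempty S.Splitting := by
  have := hS.mono_f
  have := hS.epi_g
  let P := projectiveResolution S.X₃
  let ε : P.complex.X 0 ⟶ S.X₃ := P.π.f 0
  have hε : P.complex.d 1 0 ≫ ε = 0 := P.complex_d_comp_π_f_zero
  let s : P.complex.X 0 ⟶ S.X₂ := Projective.factorThru ε S.g
  have hs : s ≫ S.g = ε := Projective.factorThru_comp _ _
  have hds : (P.complex.d 1 0 ≫ s) ≫ S.g = 0 := by rw [Category.assoc, hs, hε]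
  let φ : P.complex.X 1 ⟶ S.X₁ := hS.exact.lift _ hds
  have hφ : φ ≫ S.f = P.complex.d 1 0 ≫ s := hS.exact.lift_f _ hds
  obtain ⟨ψ, hψ⟩ := P.exists_d_comp_eq_of_subsingleton_ext_one (R := R) φ (by
    rw [← cancel_mono S.f, Category.assoc, hφ, P.complex.d_comp_d_assoc, zero_comp, zero_comp])
  have hd : P.complex.d 1 0 ≫ (s - ψ ≫ S.f) = 0 := by
    rw [Preadditive.comp_sub, reassoc_of% hψ, hφ, sub_self]
  obtain ⟨σ, hσ⟩ : ∃ σ : S.X₃ ⟶ S.X₂, ε ≫ σ = s - ψ ≫ S.f :=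
    ⟨P.exact₀.desc _ hd, P.exact₀.g_desc _ hd⟩
  have : Epi ε := inferInstanceAs (Epi (P.π.f 0))
  refine ⟨.ofExactOfSection S hS.exact σ ?_ hS.mono_f⟩
  rw [← cancel_epi ε, reassoc_of% hσ, Preadditive.sub_comp, hs, Category.assoc, S.zero,
    comp_zero, sub_zero]
  exact (Category.comp_id ε).symm

end CategoryTheory

/-- The third vertex of an exact triangle on `f` is `coker f ⊞ ker f`, provided that
`Ext¹(ker f, coker f)` vanishes. -/
lemma LinearMap.nonempty_iso_biprod_of_exact_triangle {A : Type u} [Ring A] {M P X : Type u}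
    [AddCommGroup M] [Module A M] [AddCommGroup P] [Module A P] [AddCommGroup X] [Module A X]
    (f : M →ₗ[A] P) (g : P →ₗ[A] X) (h : X →ₗ[A] M)
    (hfg : LinearMap.range f = LinearMap.ker g)
    (hgh : LinearMap.range g = LinearMap.ker h)
    (hhf : LinearMap.range h = LinearMap.ker f)
    [Subsingleton
      (((Ext ℤ (ModuleCat.{u} A) 1).obj
        (Opposite.op (ModuleCat.of A (LinearMap.ker f)))).obj
        (ModuleCat.of A (P ⧸ LinearMap.range f)))] :
    Nonempty (ModuleCat.of A X ≅
      ModuleCat.of A (P ⧸ LinearMap.range f) ⊞ ModuleCat.of A (LinearMap.ker f)) := by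
  let i : (P ⧸ LinearMap.range f) →ₗ[A] X := (LinearMap.range f).liftQ g hfg.le
  let p : X →ₗ[A] LinearMap.ker f :=
    h.codRestrict (LinearMap.ker f) fun x ↦ hhf ▸ LinearMap.mem_range_self h x
  have hi : Function.Injective i :=
    LinearMap.ker_eq_bot.mp (Submodule.ker_liftQ_eq_bot _ _ _ hfg.ge)
  have hp : Function.Surjective p := by
    rintro ⟨m, hm⟩
    obtain ⟨x, rfl⟩ := hhf.ge hm
    exact ⟨x, rfl⟩
  have hip : Function.Exact i p := by
    rw [LinearMap.exact_iff, LinearMap.ker_codRestrict, Submodule.range_liftQ, hgh]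
  let S := ModuleCat.shortComplexOfCompEqZero i p hip.linearMap_comp_eq_zero
  have hS : S.ShortExact := ModuleCat.shortComplex_shortExact S hip hi hp
  obtain ⟨σ⟩ := hS.nonempty_splitting_of_subsingleton_ext_one ℤ
  exact ⟨σ.isoBinaryBiproduct⟩

/-- algebraic skeleton of Theorem 2.3 of the paper.
If `(f, g, h)` and `(f, g′, h′)` are two exact triangles of `A`-modules sharing
the same first map `f : M → P`, and `Ext¹_A(ker f, P ⧸ range f) = 0`, then the
third vertices `X` and `X′` are isomorphic `A`-modules. -/
theorem stmt6 {A : Type u} [Ring A]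
    {M P X X' : Type u}
    [AddCommGroup M] [Module A M] [AddCommGroup P] [Module A P]
    [AddCommGroup X] [Module A X] [AddCommGroup X'] [Module A X']
    (f : M →ₗ[A] P)
    (g : P →ₗ[A] X) (h : X →ₗ[A] M)
    (g' : P →ₗ[A] X') (h' : X' →ₗ[A] M)
    (hfg : LinearMap.range f = LinearMap.ker g)
    (hgh : LinearMap.range g = LinearMap.ker h)
    (hhf : LinearMap.range h = LinearMap.ker f)
    (hfg' : LinearMap.range f = LinearMap.ker g')
    (hgh' : LinearMap.range g' = LinearMap.ker h')
    (hhf' : LinearMap.range h' = LinearMap.ker f)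
    (hext : Subsingleton
      (((Ext ℤ (ModuleCat.{u} A) 1).obj
        (Opposite.op (ModuleCat.of A (LinearMap.ker f)))).obj
        (ModuleCat.of A (P ⧸ LinearMap.range f)))) :
    Nonempty (X ≃ₗ[A] X') := by
  obtain ⟨e⟩ := f.nonempty_iso_biprod_of_exact_triangle g h hfg hgh hhf
  obtain ⟨e'⟩ := f.nonempty_iso_biprod_of_exact_triangle g' h' hfg' hgh' hhf'
  exact ⟨(e ≪≫ e'.symm).toLinearEquiv⟩
end
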